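/- arXiv:1610.01592 — 5 statements merged into one kernel-verified Lean document; each statement's English description precedes it below -/
import Mathlib

section
/- Let a > 0, b > 0, ε > 0, L_y > 0 and let f_in : ℝ × ℝ → ℝ be continuously differentiable and L_y-periodic in its second variable. Define f̄_in(x) := (1/L_y) ∫₀^{L_y} f_in(x,z) dz and g(x,y) := ∫₀^y ( f_in(x,z) − f̄_in(x) ) dz. Then for all (t,x,y) ∈ ℝ × ℝ × ℝ, f_in(x − a t, y − (b/ε) t) − f̄_in(x − a t) = −(ε/b) [ (d/dt)( g(x − a t, y − (b/ε) t) ) + a (∂_x g)(x − a t, y − (b/ε) t) ], where d/dt denotes the derivative of t ↦ g(x − a t, y − (b/ε) t). -/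
open MeasureTheory

/-- The fluctuation primitive `g(x,y) := ∫₀^y ( f_in(x,z) − f̄_in(x) ) dz`, where
`f̄_in(x) := (1/L_y) ∫₀^{L_y} f_in(x,z) dz`. -/
noncomputable def fluctPrim (Ly : ℝ) (f_in : ℝ × ℝ → ℝ) (x y : ℝ) : ℝ :=
  ∫ z in (0:ℝ)..y, (f_in (x, z) - (1 / Ly) * ∫ w in (0:ℝ)..Ly, f_in (x, w))

/-- Differentiation under an interval integral when the integrand and its derivative in the
parameter are jointly continuous. -/
theorem hasDerivAt_intervalIntegral_of_continuous {h h' : ℝ → ℝ → ℝ}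
    (hc : Continuous h.uncurry) (hc' : Continuous h'.uncurry)
    (hd : ∀ x z, HasDerivAt (fun u => h u z) (h' x z) x) (c d x : ℝ) :
    HasDerivAt (fun u => ∫ z in c..d, h u z) (∫ z in c..d, h' x z) x := by
  obtain ⟨C, hC⟩ := ((isCompact_closedBall x 1).prod
    (isCompact_uIcc (a := c) (b := d))).exists_bound_of_continuousOn
    hc'.continuousOn
  have hs (u : ℝ) : Continuous (h u) := hc.comp (Continuous.prodMk_right u)
  have hs' (u : ℝ) : Continuous (h' u) := hc'.comp (Continuous.prodMk_right u)
  refine (intervalIntegral.hasDerivAt_integral_of_dominated_loc_of_deriv_le (F' := h')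
    (bound := fun _ => C) (Metric.closedBall_mem_nhds x one_pos)
    (Filter.Eventually.of_forall fun u => (hs u).aestronglyMeasurable)
    ((hs x).intervalIntegrable c d) (hs' x).aestronglyMeasurable ?_
    intervalIntegrable_const ?_).2
  · exact ae_of_all _ fun z hz u hu => hC (u, z) ⟨hu, Set.uIoc_subset_uIcc hz⟩
  · exact ae_of_all _ fun z _ u _ => hd u z

/-- The primitive in the second variable of a function that is continuously differentiable in the
first variable is jointly differentiable. -/
theorem hasStrictFDerivAt_parametric_primitive {h h' : ℝ → ℝ → ℝ}
    (hc : Continuous h.uncurry) (hc' : Continuous h'.uncurry)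
    (hd : ∀ x z, HasDerivAt (fun u => h u z) (h' x z) x) (c : ℝ) (p : ℝ × ℝ) :
    HasStrictFDerivAt (fun q : ℝ × ℝ => ∫ z in c..q.2, h q.1 z)
      ((ContinuousLinearMap.toSpanSingleton ℝ (∫ z in c..p.2, h' p.1 z)).coprod
        (ContinuousLinearMap.toSpanSingleton ℝ (h p.1 p.2))) p := by
  refine hasStrictFDerivAt_uncurry_coprod (f := fun x y => ∫ z in c..y, h x z)
    (f₁ := fun x y => ContinuousLinearMap.toSpanSingleton ℝ (∫ z in c..y, h' x z))
    (f₂ := fun x y => ContinuousLinearMap.toSpanSingleton ℝ (h x y))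
    (Filter.Eventually.of_forall fun q => ?_) (Filter.Eventually.of_forall fun q => ?_) ?_ ?_
  · exact (hasDerivAt_intervalIntegral_of_continuous hc hc' hd c q.2 q.1).hasFDerivAt
  · have hs : Continuous (h q.1) := hc.comp (Continuous.prodMk_right q.1)
    exact (hs.integral_hasStrictDerivAt c q.2).hasDerivAt.hasFDerivAt
  · exact ((ContinuousLinearMap.toSpanSingletonCLE (𝕜 := ℝ) (E := ℝ)).continuous.comp
      (intervalIntegral.continuous_parametric_primitive_of_continuous hc')).continuousAt
  · exact ((ContinuousLinearMap.toSpanSingletonCLE (𝕜 := ℝ) (E := ℝ)).continuous.comp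
      hc).continuousAt

/-- For C¹, `L_y`-periodic (in the second variable) initial data, the fluctuation of
the exact solution satisfies
`f_in(x−at, y−(b/ε)t) − f̄_in(x−at)
  = −(ε/b) [ d/dt ( g(x−at, y−(b/ε)t) ) + a (∂_x g)(x−at, y−(b/ε)t) ]`. -/
theorem stmt_3 (a b ε Ly : ℝ) (ha : 0 < a) (hb : 0 < b) (hε : 0 < ε) (hLy : 0 < Ly)
    (f_in : ℝ × ℝ → ℝ) (hf : ContDiff ℝ 1 f_in)
    (hper : ∀ x y : ℝ, f_in (x, y + Ly) = f_in (x, y)) :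
    ∀ t x y : ℝ,
      f_in (x - a * t, y - (b / ε) * t)
          - (1 / Ly) * (∫ z in (0:ℝ)..Ly, f_in (x - a * t, z))
        = -(ε / b) *
            (deriv (fun s : ℝ => fluctPrim Ly f_in (x - a * s) (y - (b / ε) * s)) t
              + a * deriv (fun u : ℝ => fluctPrim Ly f_in u (y - (b / ε) * t)) (x - a * t)) := by
  intro t x y
  have hdf (u z : ℝ) : HasDerivAt (fun v => f_in (v, z)) (fderiv ℝ f_in (u, z) (1, 0)) u :=
    ((hf.differentiable one_ne_zero (u, z)).hasFDerivAt).comp_hasDerivAt u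
      ((hasDerivAt_id u).prodMk (hasDerivAt_const u z))
  have hcf : Continuous (Function.uncurry fun u z => f_in (u, z)) := hf.continuous
  have hcf' : Continuous (Function.uncurry fun u z => fderiv ℝ f_in (u, z) (1, 0)) :=
    (hf.continuous_fderiv one_ne_zero).clm_apply continuous_const
  have hm := intervalIntegral.continuous_parametric_intervalIntegral_of_continuous'
    (μ := volume) hcf 0 Ly
  have hm' := intervalIntegral.continuous_parametric_intervalIntegral_of_continuous'
    (μ := volume) hcf' 0 Ly
  have hG := (hasStrictFDerivAt_parametric_primitive
    (h := fun u z => f_in (u, z) - (1 / Ly) * ∫ w in (0:ℝ)..Ly, f_in (u, w))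
    (h' := fun u z => fderiv ℝ f_in (u, z) (1, 0)
      - (1 / Ly) * ∫ w in (0:ℝ)..Ly, fderiv ℝ f_in (u, w) (1, 0))
    (hcf.sub (continuous_const.mul (hm.comp continuous_fst)))
    (hcf'.sub (continuous_const.mul (hm'.comp continuous_fst)))
    (fun u z => (hdf u z).sub
      ((hasDerivAt_intervalIntegral_of_continuous hcf hcf' hdf 0 Ly u).const_mul (1 / Ly)))
    0 (x - a * t, y - b / ε * t)).hasFDerivAt
  have hline (r k : ℝ) : HasDerivAt (fun s : ℝ => r - k * s) (-k) t := by
    simpa using ((hasDerivAt_id t).const_mul k).const_sub r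
  have ht := (hG.comp_hasDerivAt t ((hline x a).prodMk (hline y (b / ε)))).deriv
  have hx := (hG.comp_hasDerivAt (x - a * t)
    ((hasDerivAt_id (x - a * t)).prodMk (hasDerivAt_const _ (y - b / ε * t)))).deriv
  simp only [Function.comp_def, id, ContinuousLinearMap.coprod_apply,
    ContinuousLinearMap.toSpanSingleton_apply, smul_eq_mul] at ht hx
  simp only [fluctPrim]
  rw [ht, hx]
  field_simp
  ring
end

section
/- Let a > 0, b > 0, L_x > 0, L_y > 0 and let f_in : ℝ × ℝ → ℝ be continuously differentiable, L_x-periodic in its first variable and L_y-periodic in its second variable. Define f̄_in(x) := (1/L_y) ∫₀^{L_y} f_in(x,z) dz. Let φ : ℝ × ℝ × ℝ → ℝ be continuously differentiable with compact support. Then there exists a constant C > 0, independent of ε, such that for every ε > 0: | ∫_ℝ ∫₀^{L_x} ∫₀^{L_y} ( f_in(x − a t, y − (b/ε) t) − f̄_in(x − a t) ) φ(t,x,y) dy dx dt | ≤ C ε. -/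
open MeasureTheory

/-- A continuous doubly periodic function on the plane is bounded. -/
lemma exists_bound_of_doubly_periodic {E : Type*} [SeminormedAddCommGroup E] {f : ℝ × ℝ → E}
    (hf : Continuous f) {p q : ℝ} (hp : 0 < p) (hq : 0 < q)
    (hfp : ∀ x y, f (x + p, y) = f (x, y)) (hfq : ∀ x y, f (x, y + q) = f (x, y)) :
    ∃ M, ∀ z, ‖f z‖ ≤ M := by
  obtain ⟨M, hM⟩ := (isCompact_Icc (a := (0 : ℝ)) (b := p)).prod
    (isCompact_Icc (a := (0 : ℝ)) (b := q)) |>.exists_bound_of_continuousOn hf.continuousOn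
  refine ⟨M, fun ⟨x, y⟩ => ?_⟩
  obtain ⟨x', hx', hxx'⟩ :=
    Function.Periodic.exists_mem_Ico₀ (f := fun x => f (x, y)) (fun x => hfp x y) hp x
  obtain ⟨y', hy', hyy'⟩ :=
    Function.Periodic.exists_mem_Ico₀ (f := fun y => f (x', y)) (fun y => hfq x' y) hq y
  rw [hxx', hyy']
  exact hM _ ⟨Set.Ico_subset_Icc_self hx', Set.Ico_subset_Icc_self hy'⟩

/-- A continuously differentiable doubly periodic function on the plane is globally Lipschitz. -/
lemma exists_lipschitzWith_of_doubly_periodic {f : ℝ × ℝ → ℝ} (hf : ContDiff ℝ 1 f) {p q : ℝ}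
    (hp : 0 < p) (hq : 0 < q)
    (hfp : ∀ x y, f (x + p, y) = f (x, y)) (hfq : ∀ x y, f (x, y + q) = f (x, y)) :
    ∃ K, LipschitzWith K f := by
  have hper : ∀ v : ℝ × ℝ, (∀ z, f (z + v) = f z) → ∀ z, fderiv ℝ f (z + v) = fderiv ℝ f z := by
    intro v hv z
    rw [← fderiv_comp_add_right, funext hv]
  obtain ⟨M, hM⟩ := exists_bound_of_doubly_periodic (hf.continuous_fderiv one_ne_zero) hp hq
    (fun x y => by simpa using hper (p, 0) (fun z => by simpa [Prod.add_def] using hfp z.1 z.2) (x, y))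
    (fun x y => by simpa using hper (0, q) (fun z => by simpa [Prod.add_def] using hfq z.1 z.2) (x, y))
  refine ⟨M.toNNReal, lipschitzWith_of_nnnorm_fderiv_le (hf.differentiable one_ne_zero) ?_⟩
  intro z
  rw [← NNReal.coe_le_coe]
  exact (hM z).trans (Real.le_coe_toNNReal M)

lemma intervalIntegral_swap_of_continuous {a b c d : ℝ} {f : ℝ → ℝ → ℝ}
    (hf : Continuous f.uncurry) :
    ∫ x in a..b, ∫ y in c..d, f x y = ∫ y in c..d, ∫ x in a..b, f x y := by
  refine intervalIntegral_intervalIntegral_swap ?_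
  exact (hf.continuousOn.integrableOn_compact (isCompact_uIcc.prod isCompact_uIcc)).mono_set
    (Set.prod_mono Set.uIoc_subset_uIcc Set.uIoc_subset_uIcc)

/-- Averaging over one fast period: the integral along the line `θ = c t` of a function which is
mean-free and periodic in `θ`, and Lipschitz and compactly supported in `t`, is `O(1 / c)`. -/
lemma abs_integral_fast_oscillation_le {F : ℝ → ℝ → ℝ} (hF : Continuous F.uncurry) {P R K c : ℝ}
    (hP : 0 < P) (hR : 0 < R) (hc : 0 < c) (hper : ∀ t, Function.Periodic (F t) P)
    (hmean : ∀ t, ∫ θ in (0 : ℝ)..P, F t θ = 0) (hsupp : ∀ t θ, R ≤ |t| → F t θ = 0)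
    (hK : ∀ t s θ, |F t θ - F s θ| ≤ K * |t - s|) :
    |∫ t in -R..R, F t (c * t)| ≤ 4 * R * K * (P / c) := by
  have hF' : ∀ {u v : ℝ → ℝ}, Continuous u → Continuous v → Continuous fun t => F (u t) (v t) :=
    fun hu hv => hF.comp (hu.prodMk hv)
  have hK0 : 0 ≤ K := by simpa using (abs_nonneg _).trans (hK 1 0 0)
  have hT : 0 < P / c := div_pos hP hc
  set T := P / c with hTdef
  have hfull : ∀ v : ℝ → ℝ, ∫ t in -R..R, F t (v t) = ∫ t, F t (v t) := by
    intro v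
    refine intervalIntegral.integral_eq_integral_of_support_subset fun t ht => ?_
    have : |t| < R := not_le.1 fun h => ht (hsupp t _ h)
    exact ⟨(abs_lt.1 this).1, (abs_lt.1 this).2.le⟩
  have hcs : ∀ v : ℝ → ℝ, HasCompactSupport fun t => F t (v t) := by
    intro v
    refine HasCompactSupport.intro (isCompact_Icc (a := -R) (b := R)) fun t ht => hsupp _ _ ?_
    by_contra h
    exact ht (abs_le.1 (not_le.1 h).le)
  set J : ℝ → ℝ := fun s => ∫ t in -R..R, F t (c * (t + s)) with hJ
  have hJc : Continuous J := by
    refine intervalIntegral.continuous_parametric_intervalIntegral_of_continuous' ?_ _ _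
    exact hF.comp (continuous_snd.prodMk
      (continuous_const.mul (continuous_snd.add continuous_fst)))
  have hJ0 : ∫ s in (0 : ℝ)..T, J s = 0 := by
    rw [hJ, intervalIntegral_swap_of_continuous (f := fun s t => F t (c * (t + s)))]
    · refine intervalIntegral.integral_zero_ae (Filter.Eventually.of_forall fun t _ => ?_)
      have h1 := intervalIntegral.integral_comp_mul_add (a := 0) (b := T) (F t) hc.ne' (c * t)
      have h2 := (hper t).intervalIntegral_add_eq (c * t) 0
      have h3 : c * T + c * t = c * t + P := by rw [hTdef]; field_simp; ring
      rw [h3, mul_zero, zero_add, h2, zero_add, hmean, smul_zero] at h1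
      rw [← h1]
      congr 1; ext s; ring_nf
    · exact hF.comp (continuous_snd.prodMk
        (continuous_const.mul (continuous_snd.add continuous_fst)))
  have hbound : ∀ s ∈ Set.uIoc 0 T, ‖(∫ t in -R..R, F t (c * t)) - J s‖ ≤ 4 * R * K * T := by
    intro s hs
    rw [Set.uIoc_of_le hT.le] at hs
    have hshift : ∫ t, F t (c * t) = ∫ t, F (t + s) (c * (t + s)) :=
      (integral_add_right_eq_self (fun t => F t (c * t)) s).symm
    have hi1 : Integrable fun t => F (t + s) (c * (t + s)) :=
      ((hF' continuous_id (continuous_const.mul continuous_id)).integrable_of_hasCompactSupport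
        (hcs fun t => c * t)).comp_add_right s
    have hi2 : Integrable fun t => F t (c * (t + s)) :=
      (hF' continuous_id (by fun_prop)).integrable_of_hasCompactSupport (hcs fun t => c * (t + s))
    rw [hJ]
    dsimp only
    rw [hfull, hfull, hshift, ← integral_sub hi1 hi2]
    set S : Set ℝ := Set.Icc (-R) R ∪ Set.Icc (-R - s) (R - s)
    have hS : ∀ t, t ∉ S → F (t + s) (c * (t + s)) - F t (c * (t + s)) = 0 := by
      intro t ht
      rw [hsupp t, hsupp (t + s), sub_zero]
      · by_contra h
        have := abs_lt.1 (not_le.1 h)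
        exact ht (Or.inr ⟨by linarith, by linarith⟩)
      · by_contra h
        exact ht (Or.inl (abs_le.1 (not_le.1 h).le))
    rw [← setIntegral_eq_integral_of_forall_compl_eq_zero hS]
    have hvol : volume.real S ≤ 4 * R := by
      refine (measureReal_union_le _ _).trans ?_
      rw [Real.volume_real_Icc_of_le (by linarith), Real.volume_real_Icc_of_le (by linarith)]
      linarith
    have hfin : volume S < ⊤ := (isCompact_Icc.union isCompact_Icc).measure_lt_top
    refine (norm_setIntegral_le_of_norm_le_const (C := K * T) hfin fun t _ => ?_).trans ?_
    · refine (hK _ _ _).trans ?_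
      rw [add_sub_cancel_left, abs_of_pos hs.1]
      exact mul_le_mul_of_nonneg_left hs.2 hK0
    · calc K * T * volume.real S ≤ K * T * (4 * R) := by gcongr
        _ = 4 * R * K * T := by ring
  have h := intervalIntegral.norm_integral_le_of_norm_le_const hbound
  rw [intervalIntegral.integral_sub (by simp) (hJc.intervalIntegrable _ _), hJ0,
    intervalIntegral.integral_const, sub_zero, sub_zero, norm_smul, Real.norm_of_nonneg hT.le,
    abs_of_pos hT, mul_comm] at h
  exact le_of_mul_le_mul_right h hT

/-- For doubly periodic C¹ initial data and a C¹ compactly supported test function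
`φ`, there is a constant `C > 0`, independent of `ε`, with
`| ∫_ℝ ∫₀^{L_x} ∫₀^{L_y} ( f_in(x−at, y−(b/ε)t) − f̄_in(x−at) ) φ(t,x,y) dy dx dt | ≤ C ε`
for every `ε > 0`. -/
theorem stmt_4 (a b Lx Ly : ℝ) (ha : 0 < a) (hb : 0 < b) (hLx : 0 < Lx) (hLy : 0 < Ly)
    (f_in : ℝ × ℝ → ℝ) (hf : ContDiff ℝ 1 f_in)
    (hperx : ∀ x y : ℝ, f_in (x + Lx, y) = f_in (x, y))
    (hpery : ∀ x y : ℝ, f_in (x, y + Ly) = f_in (x, y))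
    (φ : ℝ × ℝ × ℝ → ℝ) (hφ : ContDiff ℝ 1 φ) (hφc : HasCompactSupport φ) :
    ∃ C > 0, ∀ ε > (0:ℝ),
      |∫ t : ℝ, ∫ x in (0:ℝ)..Lx, ∫ y in (0:ℝ)..Ly,
          (f_in (x - a * t, y - (b / ε) * t)
            - (1 / Ly) * ∫ z in (0:ℝ)..Ly, f_in (x - a * t, z)) * φ (t, x, y)|
        ≤ C * ε := by
  obtain ⟨M, hM⟩ := exists_bound_of_doubly_periodic hf.continuous hLx hLy hperx hpery
  obtain ⟨K, hK⟩ := exists_lipschitzWith_of_doubly_periodic hf hLx hLy hperx hpery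
  obtain ⟨N, hN⟩ := hφc.exists_bound_of_continuous hφ.continuous
  obtain ⟨L, hL⟩ := hφ.lipschitzWith_of_hasCompactSupport hφc one_ne_zero
  obtain ⟨R, hR, hsupp⟩ : ∃ R > 0, ∀ t x y, R ≤ |t| → φ (t, x, y) = 0 := by
    obtain ⟨r, hr⟩ := hφc.isCompact.isBounded.exists_norm_le
    refine ⟨max r 0 + 1, by positivity, fun t x y ht => ?_⟩
    refine image_eq_zero_of_notMem_tsupport fun h => ?_
    have h1 : |t| ≤ r := (norm_fst_le (t, x, y)).trans (hr _ h)
    linarith [le_max_left r 0]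
  have hM0 : 0 ≤ M := (norm_nonneg _).trans (hM 0)
  have hN0 : 0 ≤ N := (norm_nonneg _).trans (hN 0)
  set m : ℝ → ℝ := fun x => (1 / Ly) * ∫ z in (0:ℝ)..Ly, f_in (x, z) with hm
  have hfc := hf.continuous
  have hφc' := hφ.continuous
  have hmc : Continuous m := by
    refine continuous_const.mul ?_
    exact intervalIntegral.continuous_parametric_intervalIntegral_of_continuous' (by fun_prop) _ _
  have hfLip : ∀ x x' z, |f_in (x, z) - f_in (x', z)| ≤ K * |x - x'| := by
    intro x x' z
    simpa [dist_eq_norm, Prod.norm_def] using hK.dist_le_mul (x, z) (x', z)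
  have hmM : ∀ x, |m x| ≤ M := by
    intro x
    have := intervalIntegral.norm_integral_le_of_norm_le_const (a := 0) (b := Ly)
      (fun z _ => hM (x, z))
    rw [sub_zero, abs_of_pos hLy, Real.norm_eq_abs] at this
    rw [hm, abs_mul, abs_of_pos (by positivity), one_div, inv_mul_le_iff₀ hLy]
    linarith
  have hmLip : ∀ x x', |m x - m x'| ≤ K * |x - x'| := by
    intro x x'
    have := intervalIntegral.norm_integral_le_of_norm_le_const (a := 0) (b := Ly)
      (f := fun z => f_in (x, z) - f_in (x', z)) (fun z _ => hfLip x x' z)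
    rw [intervalIntegral.integral_sub
      (Continuous.intervalIntegrable (by fun_prop) _ _)
      (Continuous.intervalIntegrable (by fun_prop) _ _),
      sub_zero, abs_of_pos hLy, Real.norm_eq_abs] at this
    simp only [hm]
    rw [← mul_sub, abs_mul, abs_of_pos (by positivity), one_div, inv_mul_le_iff₀ hLy]
    linarith
  set Q : ℝ := 2 * K * a * N + 2 * M * L with hQ
  have hQ0 : 0 ≤ Q := by positivity
  have key : ∀ c > 0, ∀ x y, |∫ t in -R..R, (f_in (x - a * t, y - c * t) - m (x - a * t))
      * φ (t, x, y)| ≤ 4 * R * Q * (Ly / c) := by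
    intro c hc x y
    refine abs_integral_fast_oscillation_le
      (F := fun t θ => (f_in (x - a * t, y - θ) - m (x - a * t)) * φ (t, x, y))
      ?_ hLy hR hc ?_ ?_ ?_ ?_
    · simp only [Function.uncurry_def]
      fun_prop
    · intro t θ
      dsimp only
      rw [← hpery _ (y - (θ + Ly))]
      ring_nf
    · intro t
      rw [intervalIntegral.integral_mul_const, intervalIntegral.integral_sub
        (Continuous.intervalIntegrable (by fun_prop) _ _) (by simp),
        intervalIntegral.integral_comp_sub_left (fun z => f_in (x - a * t, z))]
      have hp : Function.Periodic (fun z => f_in (x - a * t, z)) Ly := fun z => hpery _ z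
      have := hp.intervalIntegral_add_eq (y - Ly) 0
      rw [sub_add_cancel, zero_add] at this
      rw [sub_zero, this, intervalIntegral.integral_const, hm]
      simp [hLy.ne']
    · intro t θ ht
      simp [hsupp t x y ht]
    · intro t s θ
      have h1 : |φ (t, x, y) - φ (s, x, y)| ≤ L * |t - s| := by
        simpa [dist_eq_norm, Prod.norm_def] using hL.dist_le_mul (t, x, y) (s, x, y)
      have hd : |x - a * t - (x - a * s)| = a * |t - s| := by
        rw [← abs_of_pos ha, ← abs_mul, abs_of_pos ha, ← abs_neg]
        ring_nf
      have h2 := hfLip (x - a * t) (x - a * s) (y - θ)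
      have h3 := hmLip (x - a * t) (x - a * s)
      rw [hd] at h2 h3
      have h4 : |f_in (x - a * s, y - θ)| ≤ M := hM _
      have h5 := hmM (x - a * s)
      have h6 : |φ (t, x, y)| ≤ N := hN _
      calc _ = |((f_in (x - a * t, y - θ) - f_in (x - a * s, y - θ))
                - (m (x - a * t) - m (x - a * s))) * φ (t, x, y)
              + (f_in (x - a * s, y - θ) - m (x - a * s)) * (φ (t, x, y) - φ (s, x, y))| := by
            ring_nf
        _ ≤ (K * (a * |t - s|) + K * (a * |t - s|)) * N + (M + M) * (L * |t - s|) := by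
            refine (abs_add_le _ _).trans (add_le_add ?_ ?_) <;> rw [abs_mul]
            · exact mul_le_mul ((abs_sub _ _).trans (add_le_add h2 h3)) h6 (abs_nonneg _)
                (by positivity)
            · exact mul_le_mul ((abs_sub _ _).trans (add_le_add h4 h5)) h1 (abs_nonneg _)
                (by positivity)
        _ = Q * |t - s| := by rw [hQ]; ring
  refine ⟨4 * R * Q * Ly / b * Ly * Lx + 1, by positivity, fun ε hε => ?_⟩
  set G : ℝ → ℝ → ℝ → ℝ := fun t x y =>
    (f_in (x - a * t, y - (b / ε) * t) - m (x - a * t)) * φ (t, x, y) with hG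
  have hGc : Continuous fun p : ℝ × ℝ × ℝ => G p.1 p.2.1 p.2.2 := by
    simp only [hG]
    fun_prop
  change |∫ t, ∫ x in (0:ℝ)..Lx, ∫ y in (0:ℝ)..Ly, G t x y| ≤ _
  have htrunc : ∫ t, ∫ x in (0:ℝ)..Lx, ∫ y in (0:ℝ)..Ly, G t x y
      = ∫ x in (0:ℝ)..Lx, ∫ y in (0:ℝ)..Ly, ∫ t in -R..R, G t x y := by
    rw [← intervalIntegral.integral_eq_integral_of_support_subset (a := -R) (b := R)]
    · rw [intervalIntegral_swap_of_continuous
        (f := fun t x => ∫ y in (0:ℝ)..Ly, G t x y)]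
      · congr 1; ext x
        refine intervalIntegral_swap_of_continuous (f := fun t y => G t x y) ?_
        exact hGc.comp (continuous_fst.prodMk (continuous_const.prodMk continuous_snd))
      · refine intervalIntegral.continuous_parametric_intervalIntegral_of_continuous'
          (f := fun p : ℝ × ℝ => fun y => G p.1 p.2 y) ?_ _ _
        exact hGc.comp ((continuous_fst.comp continuous_fst).prodMk
          ((continuous_snd.comp continuous_fst).prodMk continuous_snd))
    · intro t ht
      have : |t| < R := not_le.1 fun h => ht (by simp [hG, hsupp t _ _ h])
      exact ⟨(abs_lt.1 this).1, (abs_lt.1 this).2.le⟩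
  rw [htrunc]
  have h := intervalIntegral.norm_integral_le_of_norm_le_const (a := 0) (b := Lx) fun x _ =>
    intervalIntegral.norm_integral_le_of_norm_le_const (a := 0) (b := Ly)
      (f := fun y => ∫ t in -R..R, G t x y) fun y _ => key (b / ε) (div_pos hb hε) x y
  rw [sub_zero, sub_zero, abs_of_pos hLx, abs_of_pos hLy] at h
  refine h.trans ?_
  have : 4 * R * Q * (Ly / (b / ε)) * Ly * Lx = 4 * R * Q * Ly / b * Ly * Lx * ε := by
    field_simp
  rw [this, add_mul]
  linarith
end

section
/- Let a > 0, b > 0, L_x > 0, L_y > 0, T > 0 and let f_in : ℝ × ℝ → ℝ be continuously differentiable, L_x-periodic in its first variable and L_y-periodic in its second variable. Define f̄_in(x) := (1/L_y) ∫₀^{L_y} f_in(x,z) dz. Then for every continuous φ : ℝ × ℝ × ℝ → ℝ with compact support contained in (0,T) × ℝ × ℝ, the integral ∫₀^T ∫₀^{L_x} ∫₀^{L_y} ( f_in(x − a t, y − (b/ε) t) − f̄_in(x − a t) ) φ(t,x,y) dy dx dt tends to 0 as ε → 0⁺. That is, the solution f^ε(t,x,y) = f_in(x − a t, y − (b/ε)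 t) of (V)_ε converges weakly to the limit solution f⁰(t,x) = f̄_in(x − a t) as ε → 0. -/
open MeasureTheory Filter

/-- Averaging a continuous function over windows of length `δ` changes its integral only by
boundary terms. -/
lemma abs_mul_integral_le_of_window_integral_le {H : ℝ → ℝ} (hH : Continuous H) {T δ M η : ℝ}
    (hT : 0 ≤ T) (hδ : 0 ≤ δ) (hM : ∀ t ∈ Set.Icc 0 (T + δ), |H t| ≤ M)
    (hη : ∀ t ∈ Set.Icc 0 T, |∫ u in t..(t + δ), H u| ≤ η) :
    |δ * ∫ t in (0 : ℝ)..T, H t| ≤ T * η + 2 * (M * δ * δ) := by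
  have hHi : ∀ u v : ℝ, IntervalIntegrable H volume u v := fun u v => hH.intervalIntegrable u v
  set K : ℝ → ℝ := fun u => ∫ t in (0 : ℝ)..u, H t with hK
  have hKc : Continuous K := intervalIntegral.continuous_primitive hHi 0
  have hKi : ∀ u v : ℝ, IntervalIntegrable K volume u v := fun u v => hKc.intervalIntegrable u v
  have hKsub : ∀ u v, K v - K u = ∫ t in u..v, H t := fun u v =>
    intervalIntegral.integral_interval_sub_left (hHi 0 v) (hHi 0 u)
  have hM0 : 0 ≤ M := (abs_nonneg _).trans (hM 0 ⟨le_rfl, by positivity⟩)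
  have hKle : ∀ u v, 0 ≤ u → u ≤ v → v ≤ T + δ → v - u ≤ δ → |K v - K u| ≤ M * δ := by
    intro u v hu huv hv huδ
    rw [hKsub, ← Real.norm_eq_abs]
    refine (intervalIntegral.norm_integral_le_of_norm_le_const (C := M) ?_).trans ?_
    · intro t ht
      rw [Set.uIoc_of_le huv] at ht
      exact hM t ⟨by linarith [ht.1], by linarith [ht.2]⟩
    · rw [abs_of_nonneg (by linarith)]
      gcongr
  have hshift : ∫ t in (0 : ℝ)..T, (K (t + δ) - K t) =
      (∫ t in T..(T + δ), K t) - ∫ t in (0 : ℝ)..δ, K t := by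
    have hKδ : Continuous fun t => K (t + δ) := hKc.comp (by fun_prop)
    rw [intervalIntegral.integral_sub (hKδ.intervalIntegrable _ _) (hKi _ _),
      intervalIntegral.integral_comp_add_right, zero_add]
    have h1 := intervalIntegral.integral_add_adjacent_intervals (hKi 0 δ) (hKi δ (T + δ))
    have h2 := intervalIntegral.integral_add_adjacent_intervals (hKi 0 T) (hKi T (T + δ))
    linarith
  have hend : (∫ t in T..(T + δ), K t) = (∫ t in T..(T + δ), (K t - K T)) + δ * K T := by
    rw [intervalIntegral.integral_sub (hKi _ _) (by simp)]
    simp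
  have b1 : |∫ t in (0 : ℝ)..T, (K (t + δ) - K t)| ≤ η * |T - 0| := by
    rw [← Real.norm_eq_abs]
    refine intervalIntegral.norm_integral_le_of_norm_le_const fun t ht => ?_
    rw [Set.uIoc_of_le hT] at ht
    rw [hKsub]
    exact hη t ⟨ht.1.le, ht.2⟩
  have b2 : |∫ t in T..(T + δ), (K t - K T)| ≤ M * δ * |T + δ - T| := by
    rw [← Real.norm_eq_abs]
    refine intervalIntegral.norm_integral_le_of_norm_le_const fun t ht => ?_
    rw [Set.uIoc_of_le (by linarith)] at ht
    exact hKle T t hT ht.1.le ht.2 (by linarith [ht.2])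
  have b3 : |∫ t in (0 : ℝ)..δ, K t| ≤ M * δ * |δ - 0| := by
    rw [← Real.norm_eq_abs]
    refine intervalIntegral.norm_integral_le_of_norm_le_const fun t ht => ?_
    rw [Set.uIoc_of_le hδ] at ht
    have := hKle 0 t le_rfl ht.1.le (by linarith [ht.2]) (by linarith [ht.2])
    simpa [hK] using this
  rw [sub_zero, abs_of_nonneg hT] at b1
  rw [add_sub_cancel_left, abs_of_nonneg hδ] at b2
  rw [sub_zero, abs_of_nonneg hδ] at b3
  change |δ * K T| ≤ _
  rw [abs_le] at *
  constructor <;> linarith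

/-- Two-scale averaging: the integral of `h (t, c * t)` tends to zero as `c → ∞` when `h` is
continuous, and periodic with zero mean in its second variable. -/
lemma tendsto_integral_oscillating_zero {h : ℝ → ℝ → ℝ} (hc : Continuous (Function.uncurry h))
    {P T : ℝ} (hP : 0 < P) (hT : 0 ≤ T) (hper : ∀ t, Function.Periodic (h t) P)
    (hmean : ∀ t, ∫ s in (0 : ℝ)..P, h t s = 0) :
    Tendsto (fun c : ℝ => ∫ t in (0 : ℝ)..T, h t (c * t)) atTop (nhds 0) := by
  have hcomp : IsCompact (Set.Icc 0 (T + 1) ×ˢ Set.Icc 0 P) := isCompact_Icc.prod isCompact_Icc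
  obtain ⟨M, hM⟩ := hcomp.exists_bound_of_continuousOn hc.continuousOn
  have hMb : ∀ t ∈ Set.Icc 0 (T + 1), ∀ s, |h t s| ≤ M := by
    intro t ht s
    obtain ⟨s', hs', heq⟩ := (hper t).exists_mem_Ico₀ hP s
    rw [heq]
    exact hM (t, s') ⟨ht, hs'.1, hs'.2.le⟩
  have huc := hcomp.uniformContinuousOn_of_continuous hc.continuousOn
  rw [Metric.uniformContinuousOn_iff_le] at huc
  rw [Metric.tendsto_atTop]
  intro e he
  obtain ⟨r, hr, hur⟩ := huc (e / (2 * (T + 1))) (by positivity)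
  have hlim : Tendsto (fun c : ℝ => P / c) atTop (nhds 0) := tendsto_const_nhds.div_atTop tendsto_id
  have hM0 : 0 ≤ M := (abs_nonneg _).trans (hMb 0 ⟨le_rfl, by positivity⟩ 0)
  have hev : ∀ᶠ c : ℝ in atTop, 0 < c ∧ P / c < min 1 (min r (e / (4 * (M + 1)))) :=
    (eventually_gt_atTop 0).and (hlim.eventually_lt_const (by positivity))
  obtain ⟨c₀, hc₀⟩ := eventually_atTop.1 hev
  refine ⟨c₀, fun c hcc => ?_⟩
  obtain ⟨hcpos, hδ⟩ := hc₀ c hcc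
  have hδpos : 0 < P / c := div_pos hP hcpos
  set δ := P / c with hδdef
  obtain ⟨hδ1, hδ2⟩ := lt_min_iff.1 hδ
  obtain ⟨hδr, hδe⟩ := lt_min_iff.1 hδ2
  have hH : Continuous fun t => h t (c * t) :=
    hc.comp (continuous_id.prodMk (continuous_const.mul continuous_id))
  have hwin : ∀ t ∈ Set.Icc 0 T,
      |∫ u in t..(t + δ), h u (c * u)| ≤ e / (2 * (T + 1)) * δ := by
    intro t ht
    have hfrozen : ∫ u in t..(t + δ), h t (c * u) = 0 := by
      rw [intervalIntegral.integral_comp_mul_left _ hcpos.ne', mul_add,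
        show c * δ = P by rw [hδdef]; field_simp,
        (hper t).intervalIntegral_add_eq (c * t) 0, zero_add, hmean, smul_zero]
    have hsub : ∫ u in t..(t + δ), h u (c * u) =
        ∫ u in t..(t + δ), (h u (c * u) - h t (c * u)) := by
      have hslice : Continuous fun u => h t (c * u) :=
        hc.comp (continuous_const.prodMk (continuous_const.mul continuous_id))
      rw [intervalIntegral.integral_sub (hH.intervalIntegrable _ _)
        (hslice.intervalIntegrable _ _), hfrozen, sub_zero]
    rw [hsub, ← Real.norm_eq_abs]
    refine (intervalIntegral.norm_integral_le_of_norm_le_const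
      (C := e / (2 * (T + 1))) fun u hu => ?_).trans_eq ?_
    · rw [Set.uIoc_of_le (by linarith)] at hu
      have hp : Function.Periodic (fun s => h u s - h t s) P := (hper u).sub (hper t)
      obtain ⟨s', hs', heq⟩ := hp.exists_mem_Ico₀ hP (c * u)
      have heq' : h u (c * u) - h t (c * u) = h u s' - h t s' := heq
      rw [heq', ← dist_eq_norm]
      refine hur (u, s') ⟨⟨by linarith [ht.1, hu.1], by linarith [ht.2, hu.2]⟩, hs'.1, hs'.2.le⟩
        (t, s') ⟨⟨ht.1, by linarith [ht.2]⟩, hs'.1, hs'.2.le⟩ ?_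
      rw [Prod.dist_eq, dist_self, max_eq_left dist_nonneg, Real.dist_eq, abs_le]
      exact ⟨by linarith [hu.1], by linarith [hu.2]⟩
    · rw [add_sub_cancel_left, abs_of_pos hδpos]
  have key := abs_mul_integral_le_of_window_integral_le hH hT hδpos.le
    (fun t ht => hMb t ⟨ht.1, by linarith [ht.2]⟩ _) hwin
  rw [abs_mul, abs_of_pos hδpos] at key
  have key' : |∫ t in (0 : ℝ)..T, h t (c * t)| ≤ T * (e / (2 * (T + 1))) + 2 * (M * δ) := by
    refine le_of_mul_le_mul_left (key.trans_eq ?_) hδpos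
    ring
  have h1 : T * (e / (2 * (T + 1))) < e / 2 := by
    rw [mul_div_assoc', div_lt_div_iff₀ (by positivity) (by norm_num)]
    nlinarith
  have h2 : 2 * (M * δ) ≤ e / 2 := by
    rw [lt_div_iff₀ (by positivity)] at hδe
    nlinarith
  rw [Real.dist_eq, sub_zero]
  linarith

/-- The deviation of a function from its mean over one period has zero mean. -/
lemma integral_sub_average_eq_zero {g : ℝ → ℝ} (hg : Continuous g) {P : ℝ} (hP : P ≠ 0) :
    ∫ s in (0 : ℝ)..P, (g s - (1 / P) * ∫ z in (0 : ℝ)..P, g z) = 0 := by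
  rw [intervalIntegral.integral_sub (hg.intervalIntegrable _ _) (by simp)]
  simp [hP]

/-- Reflecting and translating a periodic function preserves a zero mean. -/
lemma integral_comp_sub_left_eq_zero_of_periodic {g : ℝ → ℝ} {P : ℝ}
    (hper : Function.Periodic g P) (hmean : ∫ s in (0 : ℝ)..P, g s = 0) (y : ℝ) :
    ∫ s in (0 : ℝ)..P, g (y - s) = 0 := by
  rw [intervalIntegral.integral_comp_sub_left, sub_zero]
  have := hper.intervalIntegral_add_eq (y - P) 0
  rwa [sub_add_cancel, zero_add, hmean] at this

/-- Interval integrals of a jointly continuous function can be exchanged. -/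
lemma intervalIntegral_swap_of_continuous_s5 {F : ℝ → ℝ → ℝ} (hF : Continuous (Function.uncurry F))
    (p q r s : ℝ) :
    ∫ u in p..q, ∫ v in r..s, F u v = ∫ v in r..s, ∫ u in p..q, F u v := by
  refine intervalIntegral_intervalIntegral_swap ?_
  exact (hF.continuousOn.integrableOn_compact (isCompact_uIcc.prod isCompact_uIcc)).mono_set
    (Set.prod_mono Set.uIoc_subset_uIcc Set.uIoc_subset_uIcc)

/-- weak convergence of the exact solution `f^ε(t,x,y) = f_in(x−at, y−(b/ε)t)` of
`(V)_ε` towards the limit solution `f⁰(t,x) = f̄_in(x−at)` as `ε → 0⁺`: for every continuous,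
compactly supported test function `φ` with support in `(0,T) × ℝ × ℝ`, the integral
`∫₀^T ∫₀^{L_x} ∫₀^{L_y} ( f^ε − f⁰ ) φ` tends to `0`. -/
theorem stmt_5 (a b Lx Ly T : ℝ) (ha : 0 < a) (hb : 0 < b) (hLx : 0 < Lx) (hLy : 0 < Ly)
    (hT : 0 < T)
    (f_in : ℝ × ℝ → ℝ) (hf : ContDiff ℝ 1 f_in)
    (hperx : ∀ x y : ℝ, f_in (x + Lx, y) = f_in (x, y))
    (hpery : ∀ x y : ℝ, f_in (x, y + Ly) = f_in (x, y)) :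
    ∀ φ : ℝ × ℝ × ℝ → ℝ, Continuous φ → HasCompactSupport φ →
      tsupport φ ⊆ Set.Ioo 0 T ×ˢ (Set.univ : Set (ℝ × ℝ)) →
      Tendsto (fun ε : ℝ =>
          ∫ t in (0:ℝ)..T, ∫ x in (0:ℝ)..Lx, ∫ y in (0:ℝ)..Ly,
            (f_in (x - a * t, y - (b / ε) * t)
              - (1 / Ly) * ∫ z in (0:ℝ)..Ly, f_in (x - a * t, z)) * φ (t, x, y))
        (nhdsWithin 0 (Set.Ioi 0)) (nhds 0) := by
  intro φ hφ _ _
  have hfc : Continuous f_in := hf.continuous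
  set G : ℝ → ℝ → ℝ := fun X Y => f_in (X, Y) - (1 / Ly) * ∫ z in (0:ℝ)..Ly, f_in (X, z) with hG
  have havg : Continuous fun X => ∫ z in (0:ℝ)..Ly, f_in (X, z) :=
    intervalIntegral.continuous_parametric_intervalIntegral_of_continuous'
      (f := fun X z => f_in (X, z)) hfc 0 Ly
  have hGc : Continuous (Function.uncurry G) :=
    hfc.sub (continuous_const.mul (havg.comp continuous_fst))
  have hGper : ∀ X, Function.Periodic (G X) Ly := fun X Y => by simp only [hG, hpery]
  have hGmean : ∀ X, ∫ s in (0:ℝ)..Ly, G X s = 0 := fun X =>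
    integral_sub_average_eq_zero (hfc.comp (continuous_const.prodMk continuous_id)) hLy.ne'
  have hF : Continuous fun p : ((ℝ × ℝ) × ℝ) × ℝ =>
      G (p.1.2 - a * p.1.1.1) (p.2 - p.1.1.2) * φ (p.1.1.1, p.1.2, p.2) := by
    refine Continuous.mul (hGc.comp (f := fun p : ((ℝ × ℝ) × ℝ) × ℝ =>
      (p.1.2 - a * p.1.1.1, p.2 - p.1.1.2)) (by fun_prop)) (by fun_prop)
  have hF' : Continuous fun p : (ℝ × ℝ) × ℝ =>
      ∫ y in (0:ℝ)..Ly, G (p.2 - a * p.1.1) (y - p.1.2) * φ (p.1.1, p.2, y) :=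
    intervalIntegral.continuous_parametric_intervalIntegral_of_continuous'
      (f := fun (p : (ℝ × ℝ) × ℝ) y => G (p.2 - a * p.1.1) (y - p.1.2) * φ (p.1.1, p.2, y)) hF 0 Ly
  have hh : Continuous (Function.uncurry fun t s : ℝ =>
      ∫ x in (0:ℝ)..Lx, ∫ y in (0:ℝ)..Ly, G (x - a * t) (y - s) * φ (t, x, y)) :=
    intervalIntegral.continuous_parametric_intervalIntegral_of_continuous'
      (f := fun (p : ℝ × ℝ) x => ∫ y in (0:ℝ)..Ly, G (x - a * p.1) (y - p.2) * φ (p.1, x, y))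
      hF' 0 Lx
  have hlim := tendsto_integral_oscillating_zero hh hLy hT.le
    (fun t s => by
      simp only [← sub_sub, (hGper _).sub_eq])
    (fun t => by
      rw [intervalIntegral_swap_of_continuous_s5 (F := fun s x =>
        ∫ y in (0:ℝ)..Ly, G (x - a * t) (y - s) * φ (t, x, y))
        (hF'.comp (f := fun p : ℝ × ℝ => ((t, p.1), p.2)) (by fun_prop))]
      refine (intervalIntegral.integral_congr fun x _ => ?_).trans intervalIntegral.integral_zero
      change (∫ s in (0:ℝ)..Ly, ∫ y in (0:ℝ)..Ly, G (x - a * t) (y - s) * φ (t, x, y)) = 0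
      rw [intervalIntegral_swap_of_continuous_s5 (F := fun s y => G (x - a * t) (y - s) * φ (t, x, y))
        (hF.comp (f := fun p : ℝ × ℝ => (((t, p.1), x), p.2)) (by fun_prop))]
      simp only [intervalIntegral.integral_mul_const,
        integral_comp_sub_left_eq_zero_of_periodic (hGper _) (hGmean _), zero_mul,
        intervalIntegral.integral_zero])
  have hscale : Tendsto (fun ε : ℝ => b / ε) (nhdsWithin 0 (Set.Ioi 0)) atTop := by
    simpa only [div_eq_mul_inv] using tendsto_inv_nhdsGT_zero.const_mul_atTop hb
  exact hlim.comp hscale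
end

section
/- Let a > 0, b > 0, ε > 0 and let f : ℝ × ℝ × ℝ → ℝ be three times continuously differentiable with all partial derivatives up to order 3 bounded, satisfying ∂_t f + a ∂_x f + (b/ε) ∂_y f = 0 everywhere. For Δt, Δx, Δy > 0 define the IMEX truncation error T(Δt,Δx,Δy)(t,x,y) := (f(t+Δt,x,y) − f(t,x,y))/Δt + a (f(t,x,y) − f(t,x−Δx,y))/Δx + (b/ε) (f(t+Δt,x,y) − f(t+Δt,x,y−Δy))/Δy. Then there exists C > 0 such that for all Δt, Δx, Δy ∈ (0,1] and all (t,x,y) ∈ ℝ³: | T(Δt,Δx,Δy)(t,x,y) + (a Δx / 2)(1 − a Δt/Δx) ∂²_{xx} f(t,x,y) + (b Δy / (2ε))(1 + b Δt/(ε Δy)) ∂²_{yy} f(t,x,y) | ≤ C (Δt² + Δx² + Δy²). In particular the IMEX scheme is consistent with the equation and first order accurate in space and time. -/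
section Taylor

variable {E F : Type*} [NormedAddCommGroup E] [NormedSpace ℝ E]
  [NormedAddCommGroup F] [NormedSpace ℝ F]

/-- First order Taylor estimate for a function with Lipschitz derivative. -/
lemma norm_taylor_one_le {g : E → F} {M : ℝ} (hM0 : 0 ≤ M) (hg : Differentiable ℝ g)
    (hM : ∀ p q, ‖fderiv ℝ g q - fderiv ℝ g p‖ ≤ M * ‖q - p‖) (p v : E) :
    ‖g (p + v) - g p - fderiv ℝ g p v‖ ≤ M * ‖v‖ ^ 2 := by
  have key := (convex_closedBall p ‖v‖).norm_image_sub_le_of_norm_fderiv_le' (f := g)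
    (φ := fderiv ℝ g p) (C := M * ‖v‖) (x := p) (y := p + v) (𝕜 := ℝ)
    (fun x _ => hg x)
    (fun x hx => (hM p x).trans
      (mul_le_mul_of_nonneg_left (mem_closedBall_iff_norm.1 hx) hM0))
    (by simp) (by simp)
  simpa [pow_two, mul_assoc] using key

/-- Second order Taylor estimate for a function whose second derivative is Lipschitz. -/
lemma norm_taylor_two_le {f : E → F} {M : ℝ} (hM0 : 0 ≤ M) (hf : ContDiff ℝ 2 f)
    (hM : ∀ p q, ‖fderiv ℝ (fderiv ℝ f) q - fderiv ℝ (fderiv ℝ f) p‖ ≤ M * ‖q - p‖)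
    (p v : E) :
    ‖f (p + v) - f p - fderiv ℝ f p v - (1 / 2 : ℝ) • fderiv ℝ (fderiv ℝ f) p v v‖
      ≤ M * ‖v‖ ^ 3 := by
  have hsymm : IsSymmSndFDerivAt ℝ f p :=
    hf.contDiffAt.isSymmSndFDerivAt (by simp)
  have hd : Differentiable ℝ f := hf.differentiable (by norm_num)
  have hd2 : Differentiable ℝ (fderiv ℝ f) :=
    (hf.fderiv_right (m := 1) (by norm_num)).differentiable (by norm_num)
  have hderiv : ∀ u : E, HasFDerivAt
      (fun u => f (p + u) - fderiv ℝ f p u - (1 / 2 : ℝ) • fderiv ℝ (fderiv ℝ f) p u u)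
      (fderiv ℝ f (p + u) - fderiv ℝ f p - fderiv ℝ (fderiv ℝ f) p u) u := by
    intro u
    have h1 : HasFDerivAt (fun u => f (p + u)) (fderiv ℝ f (p + u)) u :=
      by
      simpa [Function.comp_def] using
        (hd (p + u)).hasFDerivAt.comp u ((hasFDerivAt_id u).const_add p)
    have h2 := (fderiv ℝ f p).hasFDerivAt (x := u)
    have h3 := ((fderiv ℝ (fderiv ℝ f) p).hasFDerivAt (x := u)).clm_apply (hasFDerivAt_id u)
    refine ((h1.sub h2).sub (h3.const_smul (1 / 2 : ℝ))).congr_fderiv ?_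
    ext w
    have h : fderiv ℝ (fderiv ℝ f) p w u = fderiv ℝ (fderiv ℝ f) p u w := hsymm w u
    simp only [sub_apply, add_apply, smul_apply, ContinuousLinearMap.flip_apply,
      ContinuousLinearMap.comp_apply, ContinuousLinearMap.id_apply, id, h]
    rw [← two_smul ℝ, smul_smul]
    norm_num
  have key := (convex_closedBall (0 : E) ‖v‖).norm_image_sub_le_of_norm_hasFDerivWithin_le
    (C := M * ‖v‖ ^ 2) (x := 0) (y := v) (𝕜 := ℝ)
    (fun u _ => (hderiv u).hasFDerivWithinAt)
    (fun u hu => (norm_taylor_one_le hM0 hd2 hM p u).trans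
      (mul_le_mul_of_nonneg_left
        (pow_le_pow_left₀ (norm_nonneg u) (mem_closedBall_zero_iff.1 hu) 2) hM0))
    (by simp) (by simp)
  refine (le_of_eq ?_).trans (key.trans (le_of_eq ?_))
  · congr 1
    simp
    abel
  · rw [sub_zero]; ring

/-- A bound on the third derivative is a Lipschitz constant for the second derivative. -/
lemma norm_fderiv_fderiv_sub_le {f : E → F} {M : ℝ} (hf : ContDiff ℝ 3 f)
    (hM : ∀ p, ‖iteratedFDeriv ℝ 3 f p‖ ≤ M) (p q : E) :
    ‖fderiv ℝ (fderiv ℝ f) q - fderiv ℝ (fderiv ℝ f) p‖ ≤ M * ‖q - p‖ := by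
  have h2 : ContDiff ℝ 1 (fderiv ℝ (fderiv ℝ f)) :=
    (hf.fderiv_right (m := 2) (by norm_num)).fderiv_right (by norm_num)
  refine convex_univ.norm_image_sub_le_of_norm_fderiv_le (𝕜 := ℝ)
    (fun x _ => h2.differentiable (by norm_num) x) (fun x _ => ?_) (Set.mem_univ p)
    (Set.mem_univ q)
  rw [← norm_iteratedFDeriv_one, norm_iteratedFDeriv_fderiv, norm_iteratedFDeriv_fderiv]
  exact hM x

/-- A derivative along a constant direction that vanishes everywhere may be differentiated. -/
lemma fderiv_fderiv_apply_eq_zero {f : E → F} (hf : ContDiff ℝ 2 f) {w : E}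
    (hw : ∀ p, fderiv ℝ f p w = 0) (p v : E) : fderiv ℝ (fderiv ℝ f) p v w = 0 := by
  have hd2 : Differentiable ℝ (fderiv ℝ f) :=
    (hf.fderiv_right (m := 1) (by norm_num)).differentiable (by norm_num)
  have h := (hd2 p).hasFDerivAt.clm_apply (hasFDerivAt_const w p)
  have h0 : (fun q => fderiv ℝ f q w) = fun _ => (0 : F) := funext hw
  rw [h0] at h
  simpa using (DFunLike.congr_fun (h.unique (hasFDerivAt_const (0 : F) p)) v)

/-- Second derivative along a curve with constant velocity. -/
lemma iteratedDeriv_two_comp {f : E → F} (hf : ContDiff ℝ 2 f) {γ : ℝ → E} {w : E}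
    (hγ : ∀ s, HasDerivAt γ w s) (s : ℝ) :
    iteratedDeriv 2 (fun u => f (γ u)) s = fderiv ℝ (fderiv ℝ f) (γ s) w w := by
  have hd : Differentiable ℝ f := hf.differentiable (by norm_num)
  have hd2 : Differentiable ℝ (fderiv ℝ f) :=
    (hf.fderiv_right (m := 1) (by norm_num)).differentiable (by norm_num)
  have h1 : deriv (fun u => f (γ u)) = fun u => fderiv ℝ f (γ u) w :=
    funext fun u => ((hd (γ u)).hasFDerivAt.comp_hasDerivAt u (hγ u)).deriv
  rw [iteratedDeriv_succ, iteratedDeriv_one, h1]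
  have h2 := ((hd2 (γ s)).hasFDerivAt.comp_hasDerivAt s (hγ s)).clm_apply
    (hasDerivAt_const s w)
  simpa using h2.deriv

end Taylor

/-- Dividing a cubic remainder by the step. -/
lemma exists_eq_mul_of_abs_le_cube {R M h : ℝ} (hh : 0 < h) (hR : |R| ≤ M * h ^ 3) :
    ∃ r, R = h * r ∧ |r| ≤ M * h ^ 2 := by
  refine ⟨R / h, by field_simp, ?_⟩
  rw [abs_div, abs_of_pos hh, div_le_iff₀ hh]
  linarith

/-- The remainders of the truncation error add up to a second order quantity. -/
lemma abs_combination_le {M a c h k l r₁ r₂ r₃ r₄ r₅ : ℝ} (hM : 0 ≤ M) (ha : 0 ≤ a)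
    (hc : 0 ≤ c) (hl : 0 ≤ l) (hr₁ : |r₁| ≤ M * h ^ 2) (hr₂ : |r₂| ≤ M * k ^ 2)
    (hr₃ : |r₃| ≤ M * l ^ 2) (hr₄ : |r₄| ≤ M * h ^ 2) (hr₅ : |r₅| ≤ M * h) :
    |r₁ - a * r₂ - c * r₃ + c * r₄ - c * l / 2 * r₅|
      ≤ M * (1 + a + 3 * c) * (h ^ 2 + k ^ 2 + l ^ 2) := by
  have hcl : 0 ≤ c * l / 2 := by positivity
  have h2 : |a * r₂| ≤ a * (M * k ^ 2) := by rw [abs_mul, abs_of_nonneg ha]; gcongr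
  have h3 : |c * r₃| ≤ c * (M * l ^ 2) := by rw [abs_mul, abs_of_nonneg hc]; gcongr
  have h4 : |c * r₄| ≤ c * (M * h ^ 2) := by rw [abs_mul, abs_of_nonneg hc]; gcongr
  have h5 : |c * l / 2 * r₅| ≤ c * l / 2 * (M * h) := by
    rw [abs_mul, abs_of_nonneg hcl]; gcongr
  have hsum : M * h ^ 2 + a * (M * k ^ 2) + c * (M * l ^ 2) + c * (M * h ^ 2)
      + c * l / 2 * (M * h) ≤ M * (1 + a + 3 * c) * (h ^ 2 + k ^ 2 + l ^ 2) := by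
    have hlh : l * h ≤ h ^ 2 + l ^ 2 := by nlinarith [sq_nonneg (h - l)]
    have hcM : 0 ≤ c * M := mul_nonneg hc hM
    have haM : 0 ≤ a * M := mul_nonneg ha hM
    have := mul_le_mul_of_nonneg_left hlh hcM
    have := mul_nonneg hM (sq_nonneg k)
    have := mul_nonneg hM (sq_nonneg l)
    have := mul_nonneg hcM (sq_nonneg k)
    have := mul_nonneg hcM (sq_nonneg l)
    have := mul_nonneg hcM (sq_nonneg h)
    have := mul_nonneg haM (sq_nonneg h)
    have := mul_nonneg haM (sq_nonneg l)
    linarith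
  rw [abs_le] at hr₁ h2 h3 h4 h5 ⊢
  constructor <;> linarith


/-- the local truncation error of the IMEX upwind scheme for
`∂_t f + a ∂_x f + (b/ε) ∂_y f = 0` equals
`−(aΔx/2)(1−aΔt/Δx) ∂²_{xx} f − (bΔy/(2ε))(1+bΔt/(εΔy)) ∂²_{yy} f + O(Δt²+Δx²+Δy²)`,
uniformly; in particular the scheme is consistent and first order accurate. -/
theorem stmt_6 (a b ε : ℝ) (ha : 0 < a) (hb : 0 < b) (hε : 0 < ε)
    (f : ℝ × ℝ × ℝ → ℝ) (hf : ContDiff ℝ 3 f)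
    (hbd : ∃ M : ℝ, ∀ i : ℕ, i ≤ 3 → ∀ p : ℝ × ℝ × ℝ, ‖iteratedFDeriv ℝ i f p‖ ≤ M)
    (hpde : ∀ t x y : ℝ,
      deriv (fun s : ℝ => f (s, x, y)) t + a * deriv (fun u : ℝ => f (t, u, y)) x
        + (b / ε) * deriv (fun v : ℝ => f (t, x, v)) y = 0) :
    ∃ C > 0, ∀ Δt Δx Δy : ℝ,
      Δt ∈ Set.Ioc (0:ℝ) 1 → Δx ∈ Set.Ioc (0:ℝ) 1 → Δy ∈ Set.Ioc (0:ℝ) 1 →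
      ∀ t x y : ℝ,
        |((f (t + Δt, x, y) - f (t, x, y)) / Δt
            + a * (f (t, x, y) - f (t, x - Δx, y)) / Δx
            + (b / ε) * (f (t + Δt, x, y) - f (t + Δt, x, y - Δy)) / Δy)
          + (a * Δx / 2) * (1 - a * Δt / Δx) * iteratedDeriv 2 (fun u : ℝ => f (t, u, y)) x
          + (b * Δy / (2 * ε)) * (1 + b * Δt / (ε * Δy))
              * iteratedDeriv 2 (fun v : ℝ => f (t, x, v)) y|
        ≤ C * (Δt ^ 2 + Δx ^ 2 + Δy ^ 2) := by
  obtain ⟨M, hM⟩ := hbd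
  have hM0 : 0 ≤ M := (norm_nonneg _).trans (hM 0 (by norm_num) 0)
  have hf2 : ContDiff ℝ 2 f := hf.of_le (by norm_num)
  have hd : Differentiable ℝ f := hf.differentiable (by norm_num)
  have hd2 : Differentiable ℝ (fderiv ℝ f) :=
    (hf2.fderiv_right (m := 1) (by norm_num)).differentiable (by norm_num)
  have hLip := norm_fderiv_fderiv_sub_le hf (hM 3 le_rfl)
  obtain ⟨c, hc⟩ : ∃ c, c = b / ε := ⟨_, rfl⟩
  have hc0 : 0 < c := hc ▸ div_pos hb hε
  have hbc : b = c * ε := by rw [hc]; field_simp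
  obtain ⟨e₀, he₀⟩ : ∃ e : ℝ × ℝ × ℝ, e = (1, 0, 0) := ⟨_, rfl⟩
  obtain ⟨e₁, he₁⟩ : ∃ e : ℝ × ℝ × ℝ, e = (0, 1, 0) := ⟨_, rfl⟩
  obtain ⟨e₂, he₂⟩ : ∃ e : ℝ × ℝ × ℝ, e = (0, 0, 1) := ⟨_, rfl⟩
  have hn₀ : ‖e₀‖ = 1 := by simp [he₀, Prod.norm_def]
  have hn₁ : ‖e₁‖ = 1 := by simp [he₁, Prod.norm_def]
  have hn₂ : ‖e₂‖ = 1 := by simp [he₂, Prod.norm_def]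
  have hγ₀ (x y s : ℝ) : HasDerivAt (fun s : ℝ => (s, x, y)) e₀ s := by
    rw [he₀]
    exact (hasDerivAt_id s).prodMk ((hasDerivAt_const s x).prodMk (hasDerivAt_const s y))
  have hγ₁ (t y s : ℝ) : HasDerivAt (fun s : ℝ => (t, s, y)) e₁ s := by
    rw [he₁]
    exact (hasDerivAt_const s t).prodMk ((hasDerivAt_id s).prodMk (hasDerivAt_const s y))
  have hγ₂ (t x s : ℝ) : HasDerivAt (fun s : ℝ => (t, x, s)) e₂ s := by
    rw [he₂]
    exact (hasDerivAt_const s t).prodMk ((hasDerivAt_const s x).prodMk (hasDerivAt_id s))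
  have hw : ∀ p, fderiv ℝ f p (e₀ + a • e₁ + c • e₂) = 0 := by
    rintro ⟨t, x, y⟩
    have h := hpde t x y
    have h0 : deriv (fun s : ℝ => f (s, x, y)) t = _ :=
      ((hd (t, x, y)).hasFDerivAt.comp_hasDerivAt t (hγ₀ x y t)).deriv
    have h1 : deriv (fun s : ℝ => f (t, s, y)) x = _ :=
      ((hd (t, x, y)).hasFDerivAt.comp_hasDerivAt x (hγ₁ t y x)).deriv
    have h2 : deriv (fun s : ℝ => f (t, x, s)) y = _ :=
      ((hd (t, x, y)).hasFDerivAt.comp_hasDerivAt y (hγ₂ t x y)).deriv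
    rw [h0, h1, h2, ← hc] at h
    simpa using h
  refine ⟨(M + 1) * (1 + a + 3 * c), by positivity, ?_⟩
  rintro Δt Δx Δy ⟨ht, -⟩ ⟨hx, -⟩ ⟨hy, -⟩ t x y
  rw [iteratedDeriv_two_comp hf2 (hγ₁ t y) x, iteratedDeriv_two_comp hf2 (hγ₂ t x) y]
  obtain ⟨p, hp⟩ : ∃ p : ℝ × ℝ × ℝ, p = (t, x, y) := ⟨_, rfl⟩
  have hq : (t + Δt, x, y) = p + Δt • e₀ := by simp [hp, he₀]
  have hpx : (t, x - Δx, y) = p + (-Δx) • e₁ := by simp [hp, he₁, sub_eq_add_neg]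
  have hqy : (t + Δt, x, y - Δy) = p + Δt • e₀ + (-Δy) • e₂ := by
    simp [hp, he₀, he₂, sub_eq_add_neg]
  rw [hqy, hq, hpx, ← hp]
  have hsymm : IsSymmSndFDerivAt ℝ f p := hf2.contDiffAt.isSymmSndFDerivAt (by simp)
  have hB := fderiv_fderiv_apply_eq_zero hf2 hw p
  have hL := hw p
  have hB₀ := hB e₀
  have hB₁ := hB e₁
  have hB₂ := hB e₂
  have hR₁ := norm_taylor_two_le hM0 hf2 hLip p (Δt • e₀)
  have hR₂ := norm_taylor_two_le hM0 hf2 hLip p ((-Δx) • e₁)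
  have hR₃ := norm_taylor_two_le hM0 hf2 hLip (p + Δt • e₀) ((-Δy) • e₂)
  have hR₄ := (ContinuousLinearMap.le_opNorm _ e₂).trans
    (mul_le_mul_of_nonneg_right (norm_taylor_one_le hM0 hd2 hLip p (Δt • e₀)) (norm_nonneg e₂))
  have hR₅ := (ContinuousLinearMap.le_opNorm₂ _ e₂ e₂).trans
    (mul_le_mul_of_nonneg_right (mul_le_mul_of_nonneg_right
      (hLip p (p + Δt • e₀)) (norm_nonneg e₂)) (norm_nonneg e₂))
  have hs₀₁ : fderiv ℝ (fderiv ℝ f) p e₁ e₀ = fderiv ℝ (fderiv ℝ f) p e₀ e₁ := hsymm e₁ e₀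
  have hs₀₂ : fderiv ℝ (fderiv ℝ f) p e₂ e₀ = fderiv ℝ (fderiv ℝ f) p e₀ e₂ := hsymm e₂ e₀
  have hs₁₂ : fderiv ℝ (fderiv ℝ f) p e₂ e₁ = fderiv ℝ (fderiv ℝ f) p e₁ e₂ := hsymm e₂ e₁
  simp only [map_add, map_smul, smul_apply, sub_apply, smul_eq_mul, norm_smul, Real.norm_eq_abs, abs_neg, abs_of_pos ht, abs_of_pos hx,
    abs_of_pos hy, hn₀, hn₁, hn₂, mul_one, add_sub_cancel_left, hs₀₁, hs₀₂, hs₁₂]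
    at hL hB₀ hB₁ hB₂ hR₁ hR₂ hR₃ hR₄ hR₅
  obtain ⟨r₁, hr₁, hr₁'⟩ := exists_eq_mul_of_abs_le_cube ht hR₁
  obtain ⟨r₂, hr₂, hr₂'⟩ := exists_eq_mul_of_abs_le_cube hx hR₂
  obtain ⟨r₃, hr₃, hr₃'⟩ := exists_eq_mul_of_abs_le_cube hy hR₃
  obtain ⟨r₄, hr₄⟩ : ∃ r, r = fderiv ℝ f (p + Δt • e₀) e₂ - fderiv ℝ f p e₂
    - Δt * fderiv ℝ (fderiv ℝ f) p e₀ e₂ := ⟨_, rfl⟩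
  obtain ⟨r₅, hr₅⟩ : ∃ r, r = fderiv ℝ (fderiv ℝ f) (p + Δt • e₀) e₂ e₂
    - fderiv ℝ (fderiv ℝ f) p e₂ e₂ := ⟨_, rfl⟩
  rw [← hr₄] at hR₄
  rw [← hr₅] at hR₅
  have hmain : ((f (p + Δt • e₀) - f p) / Δt + a * (f p - f (p + (-Δx) • e₁)) / Δx
            + (b / ε) * (f (p + Δt • e₀) - f (p + Δt • e₀ + (-Δy) • e₂)) / Δy)
          + (a * Δx / 2) * (1 - a * Δt / Δx) * fderiv ℝ (fderiv ℝ f) p e₁ e₁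
          + (b * Δy / (2 * ε)) * (1 + b * Δt / (ε * Δy)) * fderiv ℝ (fderiv ℝ f) p e₂ e₂
      = r₁ - a * r₂ - c * r₃ + c * r₄ - c * Δy / 2 * r₅ := by
    have e1 : (f (p + Δt • e₀) - f p) / Δt = fderiv ℝ f p e₀
        + Δt / 2 * fderiv ℝ (fderiv ℝ f) p e₀ e₀ + r₁ := by
      rw [div_eq_iff ht.ne']
      linear_combination hr₁
    have e2 : a * (f p - f (p + (-Δx) • e₁)) / Δx = a * (fderiv ℝ f p e₁
        - Δx / 2 * fderiv ℝ (fderiv ℝ f) p e₁ e₁ - r₂) := by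
      rw [div_eq_iff hx.ne']
      linear_combination -a * hr₂
    have e3 : (b / ε) * (f (p + Δt • e₀) - f (p + Δt • e₀ + (-Δy) • e₂)) / Δy
        = c * (fderiv ℝ f (p + Δt • e₀) e₂
        - Δy / 2 * fderiv ℝ (fderiv ℝ f) (p + Δt • e₀) e₂ e₂ - r₃) := by
      rw [div_eq_iff hy.ne', ← hc]
      linear_combination -c * hr₃
    have e4 : (a * Δx / 2) * (1 - a * Δt / Δx) = a * Δx / 2 - a ^ 2 * Δt / 2 := by
      field_simp
    have e5 : (b * Δy / (2 * ε)) * (1 + b * Δt / (ε * Δy)) = c * Δy / 2 + c ^ 2 * Δt / 2 := by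
      rw [hbc]
      field_simp
    rw [e1, e2, e3, e4, e5]
    linear_combination hL + Δt / 2 * hB₀ - a * Δt / 2 * hB₁ + c * Δt / 2 * hB₂
      - c * hr₄ + c * Δy / 2 * hr₅
  rw [hmain]
  refine (abs_combination_le hM0 ha.le hc0.le hy.le hr₁' hr₂' hr₃' hR₄ hR₅).trans ?_
  gcongr
  linarith
end

section
/- Let a > 0, b > 0, ε > 0 and let f, q : ℝ × ℝ × ℝ → ℝ be three times continuously differentiable with all partial derivatives up to order 3 bounded, satisfying the Lagrange-multiplier system ∂_t f + a ∂_x f + b ∂_y q = 0 and ∂_y f = ε ∂_y q everywhere. For Δt, Δx, Δy > 0 define the truncation error T(Δt,Δx,Δy)(t,x,y) := (f(t+Δt,x,y) − f(t,x,y))/Δt + a (f(t,x,y) − f(t,x−Δx,y))/Δx + b (q(t+Δt,x,y) − q(t+Δt,x,y−Δy))/Δy. Then there exists C > 0 such that for all Δt, Δx, Δy ∈ (0,1] and all (t,x,y) ∈ ℝ³: | T(Δt,Δx,Δy)(t,x,y) + (a Δx / 2)(1 − a Δt/Δx) ∂²_{xx} f(t,x,y) + (b Δy / (2ε))(1 +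 b Δt/(ε Δy)) ∂²_{yy} f(t,x,y) | ≤ C (Δt² + Δx² + Δy²); that is, the Lagrange-multiplier scheme has the same local truncation error as the IMEX scheme and is first order accurate in space and time. -/
/-- A crude first-order mean value estimate around `0`. -/
theorem abs_sub_le_of_hasDerivAt_of_abs_le {g g' : ℝ → ℝ} {K h : ℝ}
    (hg : ∀ s, HasDerivAt g (g' s) s) (hK : ∀ s, |s| ≤ |h| → |g' s| ≤ K) :
    |g h - g 0| ≤ K * |h| := by
  have key := (convex_closedBall (0 : ℝ) |h|).norm_image_sub_le_of_norm_hasDerivWithin_le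
    (f := g) (f' := g') (C := K) (x := 0) (y := h)
    (fun s _ => (hg s).hasDerivWithinAt)
    (fun s hs => hK s (by simpa using hs)) (by simp) (by simp)
  simpa using key

theorem abs_taylor_one_le {g g₁ g₂ : ℝ → ℝ} {K : ℝ}
    (hg : ∀ s, HasDerivAt g (g₁ s) s) (hg₁ : ∀ s, HasDerivAt g₁ (g₂ s) s)
    (hK0 : 0 ≤ K) (hK : ∀ s, |g₂ s| ≤ K) (h : ℝ) :
    |g h - g 0 - h * g₁ 0| ≤ K * |h| ^ 2 := by
  have key := abs_sub_le_of_hasDerivAt_of_abs_le (g := fun s => g s - s * g₁ 0)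
    (g' := fun s => g₁ s - 1 * g₁ 0) (K := K * |h|) (h := h)
    (fun s => (hg s).sub ((hasDerivAt_id s).mul_const _))
    (fun s hs => by
      have := abs_sub_le_of_hasDerivAt_of_abs_le (h := s) hg₁ (fun r _ => hK r)
      rw [one_mul]
      exact this.trans (mul_le_mul_of_nonneg_left hs hK0))
  convert key using 1
  · congr 1; ring
  · ring

theorem abs_taylor_two_le {g g₁ g₂ g₃ : ℝ → ℝ} {K : ℝ}
    (hg : ∀ s, HasDerivAt g (g₁ s) s) (hg₁ : ∀ s, HasDerivAt g₁ (g₂ s) s)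
    (hg₂ : ∀ s, HasDerivAt g₂ (g₃ s) s)
    (hK0 : 0 ≤ K) (hK : ∀ s, |g₃ s| ≤ K) (h : ℝ) :
    |g h - g 0 - h * g₁ 0 - h ^ 2 / 2 * g₂ 0| ≤ K * |h| ^ 3 := by
  have hd (s : ℝ) : HasDerivAt (fun s => g s - s * g₁ 0 - s ^ 2 / 2 * g₂ 0)
      (g₁ s - g₁ 0 - s * g₂ 0) s := by
    refine (((hg s).sub ((hasDerivAt_id s).mul_const (g₁ 0))).sub
      ((((hasDerivAt_id s).pow 2).div_const 2).mul_const (g₂ 0))).congr_deriv ?_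
    simp
  have key := abs_sub_le_of_hasDerivAt_of_abs_le (K := K * |h| ^ 2) (h := h) hd
    (fun s hs => (abs_taylor_one_le hg₁ hg₂ hK0 hK s).trans (by gcongr))
  convert key using 1
  · congr 1; ring
  · ring

section DirectionalDerivative

variable {E : Type*} [NormedAddCommGroup E] [NormedSpace ℝ E]

/-- The derivative of `F` in the direction `v`, as a function of the base point. -/
noncomputable def dirDeriv (v : E) (F : E → ℝ) (p : E) : ℝ := fderiv ℝ F p v

theorem ContDiff.dirDeriv {m n : WithTop ℕ∞} {F : E → ℝ} (hF : ContDiff ℝ n F)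
    (hmn : m + 1 ≤ n) (v : E) : ContDiff ℝ m (dirDeriv v F) :=
  (hF.fderiv_right hmn).clm_apply contDiff_const

theorem hasDerivAt_comp_add_smul {F : E → ℝ} (hF : Differentiable ℝ F) (p v : E) (s : ℝ) :
    HasDerivAt (fun s : ℝ => F (p + s • v)) (dirDeriv v F (p + s • v)) s := by
  have h1 : HasDerivAt (fun s : ℝ => p + s • v) v s := by
    simpa using ((hasDerivAt_id s).smul_const v).const_add p
  exact (hF (p + s • v)).hasFDerivAt.comp_hasDerivAt s h1

theorem norm_iteratedFDeriv_dirDeriv_le {F : E → ℝ} {n : ℕ} {m : WithTop ℕ∞}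
    (hF : ContDiff ℝ m F) (hn : (n : WithTop ℕ∞) + 1 ≤ m) {v : E} (hv : ‖v‖ ≤ 1) (p : E) :
    ‖iteratedFDeriv ℝ n (dirDeriv v F) p‖ ≤ ‖iteratedFDeriv ℝ (n + 1) F p‖ := by
  have h := norm_iteratedFDeriv_clm_apply_const (c := v) (x := p) (N := (n : WithTop ℕ∞)) (n := n)
    (hF.fderiv_right hn).contDiffAt le_rfl
  rw [norm_iteratedFDeriv_fderiv] at h
  exact h.trans (mul_le_of_le_one_left (norm_nonneg _) hv)

theorem abs_dirDeriv_three_le {F : E → ℝ} (hF : ContDiff ℝ 3 F) {u v w : E}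
    (hu : ‖u‖ ≤ 1) (hv : ‖v‖ ≤ 1) (hw : ‖w‖ ≤ 1) (p : E) :
    |dirDeriv u (dirDeriv v (dirDeriv w F)) p| ≤ ‖iteratedFDeriv ℝ 3 F p‖ := by
  have h1 := hF.dirDeriv (m := 2) (by norm_num) w
  have h2 := h1.dirDeriv (m := 1) (by norm_num) v
  have e0 := norm_iteratedFDeriv_dirDeriv_le (n := 0) h2 (by norm_num) hu p
  have e1 := norm_iteratedFDeriv_dirDeriv_le (n := 1) h1 (by norm_num) hv p
  have e2 := norm_iteratedFDeriv_dirDeriv_le (n := 2) hF (by norm_num) hw p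
  rw [norm_iteratedFDeriv_zero, Real.norm_eq_abs] at e0
  exact e0.trans (e1.trans e2)

theorem dirDeriv_comm {F : E → ℝ} (hF : ContDiff ℝ 2 F) (u v : E) :
    dirDeriv u (dirDeriv v F) = dirDeriv v (dirDeriv u F) := by
  have hd : Differentiable ℝ (fderiv ℝ F) :=
    (hF.fderiv_right (m := 1) (by norm_num)).differentiable (by norm_num)
  have expand (u v p : E) : dirDeriv u (dirDeriv v F) p = fderiv ℝ (fderiv ℝ F) p u v := by
    have := (hd p).hasFDerivAt.clm_apply (hasFDerivAt_const v p)
    unfold dirDeriv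
    rw [this.fderiv]
    simp
  funext p
  rw [expand, expand]
  exact (hF.contDiffAt.isSymmSndFDerivAt (by simp)) u v

theorem dirDeriv_neg_mul_sub_mul {F G : E → ℝ} (hF : Differentiable ℝ F)
    (hG : Differentiable ℝ G) (a c : ℝ) (v : E) :
    dirDeriv v (fun p => -a * F p - c * G p) =
      fun p => -a * dirDeriv v F p - c * dirDeriv v G p := by
  funext p
  have := ((hF p).hasFDerivAt.const_mul (-a)).sub ((hG p).hasFDerivAt.const_mul c)
  unfold dirDeriv
  rw [HasFDerivAt.fderiv (f := fun p => -a * F p - c * G p) this]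
  simp

theorem abs_dirDeriv_sub_le {F : E → ℝ} (hF : Differentiable ℝ F) {v : E} {K : ℝ}
    (hK : ∀ p, |dirDeriv v F p| ≤ K) (p : E) (h : ℝ) :
    |F (p + h • v) - F p| ≤ K * |h| := by
  simpa using abs_sub_le_of_hasDerivAt_of_abs_le (h := h)
    (hasDerivAt_comp_add_smul hF p v) (fun s _ => hK _)

theorem abs_dirDeriv_taylor_one_le {F : E → ℝ} (hF : ContDiff ℝ 2 F) {v : E} {K : ℝ}
    (hK0 : 0 ≤ K) (hK : ∀ p, |dirDeriv v (dirDeriv v F) p| ≤ K) (p : E) (h : ℝ) :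
    |F (p + h • v) - F p - h * dirDeriv v F p| ≤ K * |h| ^ 2 := by
  have h1 := hF.dirDeriv (m := 1) (by norm_num) v
  simpa only [zero_smul, add_zero] using abs_taylor_one_le
    (hasDerivAt_comp_add_smul (hF.differentiable (by norm_num)) p v)
    (hasDerivAt_comp_add_smul (h1.differentiable (by norm_num)) p v) hK0 (fun s => hK _) h

theorem abs_dirDeriv_taylor_two_le {F : E → ℝ} (hF : ContDiff ℝ 3 F) {v : E} {K : ℝ}
    (hK0 : 0 ≤ K) (hK : ∀ p, |dirDeriv v (dirDeriv v (dirDeriv v F)) p| ≤ K) (p : E) (h : ℝ) :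
    |F (p + h • v) - F p - h * dirDeriv v F p - h ^ 2 / 2 * dirDeriv v (dirDeriv v F) p|
      ≤ K * |h| ^ 3 := by
  have h1 := hF.dirDeriv (m := 2) (by norm_num) v
  have h2 := h1.dirDeriv (m := 1) (by norm_num) v
  simpa only [zero_smul, add_zero] using abs_taylor_two_le
    (hasDerivAt_comp_add_smul (hF.differentiable (by norm_num)) p v)
    (hasDerivAt_comp_add_smul (h1.differentiable (by norm_num)) p v)
    (hasDerivAt_comp_add_smul (h2.differentiable (by norm_num)) p v) hK0 (fun s => hK _) h

end DirectionalDerivative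

section Coordinates

variable {F : ℝ × ℝ × ℝ → ℝ}

theorem deriv_fst_eq_dirDeriv (hF : Differentiable ℝ F) (t x y : ℝ) :
    deriv (fun s : ℝ => F (s, x, y)) t = dirDeriv (1, 0, 0) F (t, x, y) := by
  simpa using (hasDerivAt_comp_add_smul hF (0, x, y) (1, 0, 0) t).deriv

theorem deriv_snd_eq_dirDeriv (hF : Differentiable ℝ F) (t x y : ℝ) :
    deriv (fun u : ℝ => F (t, u, y)) x = dirDeriv (0, 1, 0) F (t, x, y) := by
  simpa using (hasDerivAt_comp_add_smul hF (t, 0, y) (0, 1, 0) x).deriv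

theorem deriv_thd_eq_dirDeriv (hF : Differentiable ℝ F) (t x y : ℝ) :
    deriv (fun v : ℝ => F (t, x, v)) y = dirDeriv (0, 0, 1) F (t, x, y) := by
  simpa using (hasDerivAt_comp_add_smul hF (t, x, 0) (0, 0, 1) y).deriv

theorem iteratedDeriv_two_snd_eq_dirDeriv (hF : ContDiff ℝ 2 F) (t x y : ℝ) :
    iteratedDeriv 2 (fun u : ℝ => F (t, u, y)) x =
      dirDeriv (0, 1, 0) (dirDeriv (0, 1, 0) F) (t, x, y) := by
  rw [iteratedDeriv_succ, iteratedDeriv_one,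
    funext fun u => deriv_snd_eq_dirDeriv (hF.differentiable (by norm_num)) t u y]
  exact deriv_snd_eq_dirDeriv
    ((hF.dirDeriv (m := 1) (by norm_num) _).differentiable (by norm_num)) t x y

theorem iteratedDeriv_two_thd_eq_dirDeriv (hF : ContDiff ℝ 2 F) (t x y : ℝ) :
    iteratedDeriv 2 (fun v : ℝ => F (t, x, v)) y =
      dirDeriv (0, 0, 1) (dirDeriv (0, 0, 1) F) (t, x, y) := by
  rw [iteratedDeriv_succ, iteratedDeriv_one,
    funext fun v => deriv_thd_eq_dirDeriv (hF.differentiable (by norm_num)) t x v]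
  exact deriv_thd_eq_dirDeriv
    ((hF.dirDeriv (m := 1) (by norm_num) _).differentiable (by norm_num)) t x y

/-- Integrating the constraint `∂_y f = ε ∂_y q` turns increments of `q` into increments of `f`. -/
theorem sub_eq_mul_sub_of_deriv_eq {f q : ℝ × ℝ × ℝ → ℝ} {ε : ℝ}
    (hf : Differentiable ℝ f) (hq : Differentiable ℝ q)
    (h : ∀ t x y : ℝ,
      deriv (fun v : ℝ => f (t, x, v)) y = ε * deriv (fun v : ℝ => q (t, x, v)) y)
    (t x y z : ℝ) : f (t, x, y) - f (t, x, z) = ε * (q (t, x, y) - q (t, x, z)) := by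
  have df : Differentiable ℝ (fun v : ℝ => f (t, x, v)) := by fun_prop
  have dq : Differentiable ℝ (fun v : ℝ => q (t, x, v)) := by fun_prop
  have hd (v : ℝ) : HasDerivAt (fun v => f (t, x, v) - ε * q (t, x, v)) 0 v := by
    have := (df v).hasDerivAt.sub ((dq v).hasDerivAt.const_mul ε)
    rwa [h t x v, sub_self] at this
  have := is_const_of_deriv_eq_zero (fun v => (hd v).differentiableAt) (fun v => (hd v).deriv) y z
  linarith

end Coordinates

/-- Combination of the Taylor remainders, with `f_t` already eliminated through the transport
equation. -/
theorem truncation_remainder_le {a c M τ h k f₀ fT fX fTY f₁ f₂ f₂T f₁₁ f₁₂ f₂₂ f₂₂T : ℝ}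
    (ha : 0 < a) (hc : 0 < c) (hM : 0 ≤ M) (hτ : 0 < τ) (hh : 0 < h) (hk : 0 < k)
    (r₁ : |fT - f₀ - τ * (-a * f₁ - c * f₂)
      - τ ^ 2 / 2 * (-a * (-a * f₁₁ - c * f₁₂) - c * (-a * f₁₂ - c * f₂₂))| ≤ M * τ ^ 3)
    (r₂ : |fX - f₀ - -h * f₁ - (-h) ^ 2 / 2 * f₁₁| ≤ M * h ^ 3)
    (r₃ : |fTY - fT - -k * f₂T - (-k) ^ 2 / 2 * f₂₂T| ≤ M * k ^ 3)
    (r₄ : |f₂T - f₂ - τ * (-a * f₁₂ - c * f₂₂)| ≤ M * τ ^ 2)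
    (r₅ : |f₂₂T - f₂₂| ≤ M * τ) :
    |((fT - f₀) / τ + a * (f₀ - fX) / h + c * (fT - fTY) / k)
        + (a * h / 2) * (1 - a * τ / h) * f₁₁ + (c * k / 2) * (1 + c * τ / k) * f₂₂|
      ≤ (M + 1) * (1 + a + 2 * c) * (τ ^ 2 + h ^ 2 + k ^ 2) := by
  set R₁ := fT - f₀ - τ * (-a * f₁ - c * f₂)
      - τ ^ 2 / 2 * (-a * (-a * f₁₁ - c * f₁₂) - c * (-a * f₁₂ - c * f₂₂)) with hR₁
  set R₂ := fX - f₀ - -h * f₁ - (-h) ^ 2 / 2 * f₁₁ with hR₂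
  set R₃ := fTY - fT - -k * f₂T - (-k) ^ 2 / 2 * f₂₂T with hR₃
  set R₄ := f₂T - f₂ - τ * (-a * f₁₂ - c * f₂₂) with hR₄
  set R₅ := f₂₂T - f₂₂ with hR₅
  have hsum : ((fT - f₀) / τ + a * (f₀ - fX) / h + c * (fT - fTY) / k)
        + (a * h / 2) * (1 - a * τ / h) * f₁₁ + (c * k / 2) * (1 + c * τ / k) * f₂₂
      = R₁ / τ - a * (R₂ / h) - c * (R₃ / k) + c * R₄ - c * (k / 2 * R₅) := by
    rw [hR₁, hR₂, hR₃, hR₄, hR₅]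
    field_simp
    ring
  have s₁ : |R₁ / τ| ≤ M * τ ^ 2 := by
    rw [abs_div, abs_of_pos hτ, div_le_iff₀ hτ]; linarith
  have s₂ : |a * (R₂ / h)| ≤ a * (M * h ^ 2) := by
    rw [abs_mul, abs_of_pos ha, abs_div, abs_of_pos hh]
    gcongr
    rw [div_le_iff₀ hh]; linarith
  have s₃ : |c * (R₃ / k)| ≤ c * (M * k ^ 2) := by
    rw [abs_mul, abs_of_pos hc, abs_div, abs_of_pos hk]
    gcongr
    rw [div_le_iff₀ hk]; linarith
  have s₄ : |c * R₄| ≤ c * (M * τ ^ 2) := by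
    rw [abs_mul, abs_of_pos hc]; gcongr
  have s₅ : |c * (k / 2 * R₅)| ≤ c * (k / 2 * (M * τ)) := by
    rw [abs_mul, abs_of_pos hc, abs_mul, abs_of_pos (half_pos hk)]; gcongr
  have hkτ : c * (k / 2 * (M * τ)) ≤ c * M * (τ ^ 2 + k ^ 2) := by
    have : k / 2 * τ ≤ τ ^ 2 + k ^ 2 := by nlinarith [sq_nonneg (k - τ), sq_nonneg τ, sq_nonneg k]
    calc c * (k / 2 * (M * τ)) = c * M * (k / 2 * τ) := by ring
      _ ≤ _ := by gcongr
  have hle : M * τ ^ 2 + a * (M * h ^ 2) + c * (M * k ^ 2) + c * (M * τ ^ 2)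
      + c * M * (τ ^ 2 + k ^ 2) ≤ (M + 1) * (1 + a + 2 * c) * (τ ^ 2 + h ^ 2 + k ^ 2) := by
    rw [← sub_nonneg]
    ring_nf
    positivity
  rw [hsum]
  rw [abs_le] at s₁ s₂ s₃ s₄ s₅ ⊢
  constructor <;> linarith [s₁.1, s₁.2, s₂.1, s₂.2, s₃.1, s₃.2, s₄.1, s₄.2, s₅.1, s₅.2]


/-- the local truncation error of the Lagrange-multiplier scheme for the system
`∂_t f + a ∂_x f + b ∂_y q = 0`, `∂_y f = ε ∂_y q` equals
`−(aΔx/2)(1−aΔt/Δx) ∂²_{xx} f − (bΔy/(2ε))(1+bΔt/(εΔy)) ∂²_{yy} f + O(Δt²+Δx²+Δy²)`,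
i.e. the same as for the IMEX scheme; the scheme is first order accurate. -/
theorem stmt_10 (a b ε : ℝ) (ha : 0 < a) (hb : 0 < b) (hε : 0 < ε)
    (f q : ℝ × ℝ × ℝ → ℝ) (hf : ContDiff ℝ 3 f) (hq : ContDiff ℝ 3 q)
    (hbdf : ∃ M : ℝ, ∀ i : ℕ, i ≤ 3 → ∀ p : ℝ × ℝ × ℝ, ‖iteratedFDeriv ℝ i f p‖ ≤ M)
    (hbdq : ∃ M : ℝ, ∀ i : ℕ, i ≤ 3 → ∀ p : ℝ × ℝ × ℝ, ‖iteratedFDeriv ℝ i q p‖ ≤ M)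
    (hpde1 : ∀ t x y : ℝ,
      deriv (fun s : ℝ => f (s, x, y)) t + a * deriv (fun u : ℝ => f (t, u, y)) x
        + b * deriv (fun v : ℝ => q (t, x, v)) y = 0)
    (hpde2 : ∀ t x y : ℝ,
      deriv (fun v : ℝ => f (t, x, v)) y = ε * deriv (fun v : ℝ => q (t, x, v)) y) :
    ∃ C > 0, ∀ Δt Δx Δy : ℝ,
      Δt ∈ Set.Ioc (0:ℝ) 1 → Δx ∈ Set.Ioc (0:ℝ) 1 → Δy ∈ Set.Ioc (0:ℝ) 1 →
      ∀ t x y : ℝ,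
        |((f (t + Δt, x, y) - f (t, x, y)) / Δt
            + a * (f (t, x, y) - f (t, x - Δx, y)) / Δx
            + b * (q (t + Δt, x, y) - q (t + Δt, x, y - Δy)) / Δy)
          + (a * Δx / 2) * (1 - a * Δt / Δx) * iteratedDeriv 2 (fun u : ℝ => f (t, u, y)) x
          + (b * Δy / (2 * ε)) * (1 + b * Δt / (ε * Δy))
              * iteratedDeriv 2 (fun v : ℝ => f (t, x, v)) y|
        ≤ C * (Δt ^ 2 + Δx ^ 2 + Δy ^ 2) := by
  obtain ⟨M, hM⟩ := hbdf
  have hM3 (p) := hM 3 le_rfl p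
  have hM0 : 0 ≤ M := (norm_nonneg _).trans (hM3 0)
  obtain ⟨c, hc⟩ : ∃ c, c = b / ε := ⟨_, rfl⟩
  have hc0 : 0 < c := hc ▸ div_pos hb hε
  have hbc : b = c * ε := by rw [hc]; field_simp
  let e₀ : ℝ × ℝ × ℝ := (1, 0, 0)
  let e₁ : ℝ × ℝ × ℝ := (0, 1, 0)
  let e₂ : ℝ × ℝ × ℝ := (0, 0, 1)
  have ne₀ : ‖e₀‖ ≤ 1 := by simp [e₀, Prod.norm_def]
  have ne₁ : ‖e₁‖ ≤ 1 := by simp [e₁, Prod.norm_def]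
  have ne₂ : ‖e₂‖ ≤ 1 := by simp [e₂, Prod.norm_def]
  have hf2 : ContDiff ℝ 2 f := hf.of_le (by norm_num)
  have df : Differentiable ℝ f := hf.differentiable (by norm_num)
  have dq : Differentiable ℝ q := hq.differentiable (by norm_num)
  have cf (v) : ContDiff ℝ 2 (dirDeriv v f) := hf.dirDeriv (by norm_num) v
  have cff (v w) : ContDiff ℝ 1 (dirDeriv w (dirDeriv v f)) := (cf v).dirDeriv (by norm_num) w
  have ddf (v) : Differentiable ℝ (dirDeriv v f) := (cf v).differentiable (by norm_num)
  have hpde : dirDeriv e₀ f = fun p => -a * dirDeriv e₁ f p - c * dirDeriv e₂ f p := by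
    funext ⟨t, x, y⟩
    have h1 := hpde1 t x y
    have h2 := hpde2 t x y
    rw [deriv_fst_eq_dirDeriv df, deriv_snd_eq_dirDeriv df, hbc, mul_assoc, ← h2,
      deriv_thd_eq_dirDeriv df] at h1
    linarith
  have hdir (v p) : dirDeriv v (dirDeriv e₀ f) p =
      -a * dirDeriv v (dirDeriv e₁ f) p - c * dirDeriv v (dirDeriv e₂ f) p := by
    rw [hpde, dirDeriv_neg_mul_sub_mul (ddf _) (ddf _)]
  refine ⟨(M + 1) * (1 + a + 2 * c), by positivity, ?_⟩
  rintro Δt Δx Δy ⟨ht, -⟩ ⟨hx, -⟩ ⟨hy, -⟩ t x y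
  have r₁ := abs_dirDeriv_taylor_two_le hf hM0
    (fun p => (abs_dirDeriv_three_le hf ne₀ ne₀ ne₀ p).trans (hM3 p)) (t, x, y) Δt
  have r₂ := abs_dirDeriv_taylor_two_le hf hM0
    (fun p => (abs_dirDeriv_three_le hf ne₁ ne₁ ne₁ p).trans (hM3 p)) (t, x, y) (-Δx)
  have r₃ := abs_dirDeriv_taylor_two_le hf hM0
    (fun p => (abs_dirDeriv_three_le hf ne₂ ne₂ ne₂ p).trans (hM3 p)) (t + Δt, x, y) (-Δy)
  have r₄ := abs_dirDeriv_taylor_one_le (cf e₂) hM0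
    (fun p => (abs_dirDeriv_three_le hf ne₀ ne₀ ne₂ p).trans (hM3 p)) (t, x, y) Δt
  have r₅ := abs_dirDeriv_sub_le ((cff e₂ e₂).differentiable (by norm_num))
    (fun p => (abs_dirDeriv_three_le hf ne₀ ne₂ ne₂ p).trans (hM3 p)) (t, x, y) Δt
  have hp₀ : (t, x, y) + Δt • e₀ = (t + Δt, x, y) := by simp [e₀]
  have hp₁ : (t, x, y) + (-Δx) • e₁ = (t, x - Δx, y) := by simp [e₁, sub_eq_add_neg]
  have hp₂ : (t + Δt, x, y) + (-Δy) • e₂ = (t + Δt, x, y - Δy) := by simp [e₂, sub_eq_add_neg]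
  rw [hp₀, abs_of_pos ht] at r₁ r₄ r₅
  rw [hp₁, abs_neg, abs_of_pos hx] at r₂
  rw [hp₂, abs_neg, abs_of_pos hy] at r₃
  have h01 := (congrFun (dirDeriv_comm hf2 e₀ e₁) _).trans (hdir e₁ (t, x, y))
  have h02 := (congrFun (dirDeriv_comm hf2 e₀ e₂) _).trans (hdir e₂ (t, x, y))
  rw [dirDeriv_comm hf2 e₂ e₁] at h02
  rw [hdir, h01, h02, congrFun hpde (t, x, y)] at r₁
  rw [h02] at r₄
  have hqf := sub_eq_mul_sub_of_deriv_eq df dq hpde2 (t + Δt) x y (y - Δy)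
  have hbq : b * (q (t + Δt, x, y) - q (t + Δt, x, y - Δy)) =
      c * (f (t + Δt, x, y) - f (t + Δt, x, y - Δy)) := by rw [hqf, hbc]; ring
  have hb1 : b * Δy / (2 * ε) = c * Δy / 2 := by rw [hbc]; field_simp
  have hb2 : b * Δt / (ε * Δy) = c * Δt / Δy := by rw [hbc]; field_simp
  rw [iteratedDeriv_two_snd_eq_dirDeriv hf2, iteratedDeriv_two_thd_eq_dirDeriv hf2, hbq, hb1, hb2]
  exact truncation_remainder_le ha hc0 hM0 ht hx hy r₁ r₂ r₃ r₄ r₅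
end
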